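/- Let ε > 0 and let (μ_n)_{n∈ℕ} be a sequence in M with I := ⋂_{n∈ℕ} [Eμ_n − ε, Eμ_n + ε] nonempty, and suppose there exists m ∈ I such that max{ (m − x)⁺, R_{μ_k}(x) − ε } ≤ R_{μ_n}(x) + ε for all k ≤ n and all x ∈ ℝ. Then there exist infinitely many peacocks (ν_n)_{n∈ℕ} satisfying d^SL(μ_n, ν_n) ≤ ε for all n ∈ ℕ. -/

import Mathlib

open MeasureTheory Filter Set
open scoped ENNReal

/-- Call function `R_μ(x) = ∫ (y−x)⁺ μ(dy)`. -/
noncomputable def callFn (μ : Measure ℝ) (x : ℝ) : ℝ := ∫ y, max (y - x) 0 ∂μ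

/-- Mean `Eμ = ∫ y μ(dy)`. -/
noncomputable def meanM (μ : Measure ℝ) : ℝ := ∫ y, y ∂μ

/-- Distribution function `F_μ(x) = μ((−∞,x])`. -/
noncomputable def cdfM (μ : Measure ℝ) (x : ℝ) : ℝ := (μ (Set.Iic x)).toReal

/-- Membership in `M`: Borel probability measure on ℝ with finite first moment. -/
def MemM (μ : Measure ℝ) : Prop :=
  IsProbabilityMeasure μ ∧ Integrable (fun y => y) μ

/-- Convex order `μ ≤_c ν`. -/
def ConvexOrder (μ ν : Measure ℝ) : Prop :=
  ∀ φ : ℝ → ℝ, ConvexOn ℝ Set.univ φ → Integrable φ μ → Integrable φ ν →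
    ∫ y, φ y ∂μ ≤ ∫ y, φ y ∂ν

/-- Infinity Wasserstein distance via distribution functions, valued in `[0,∞]`,
with `inf ∅ = ∞`. -/
noncomputable def Winf (μ ν : Measure ℝ) : ℝ≥0∞ :=
  sInf (ENNReal.ofReal '' {ε : ℝ | 0 < ε ∧ ∀ x : ℝ,
    cdfM μ (x - ε) ≤ cdfM ν x ∧ cdfM ν x ≤ cdfM μ (x + ε)})

/-- Membership in the closed ball `B^∞(μ,ε)` (within `M`). -/
def InBallWinf (μ : Measure ℝ) (ε : ℝ) (ν : Measure ℝ) : Prop :=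
  MemM ν ∧ Winf μ ν ≤ ENNReal.ofReal ε

/-- `conv2 f g`: the largest convex function majorized by `min f g`, pointwise. -/
noncomputable def conv2 (f g : ℝ → ℝ) (x : ℝ) : ℝ :=
  sSup {z : ℝ | ∃ h : ℝ → ℝ, ConvexOn ℝ Set.univ h ∧ (∀ y, h y ≤ min (f y) (g y)) ∧ z = h x}

/-- `R^min_μ(x; m, ε)`. -/
noncomputable def RminW (μ : Measure ℝ) (m ε x : ℝ) : ℝ :=
  max (m + callFn μ (x - ε) - (meanM μ + ε)) (callFn μ (x + ε))

/-- `R^max_μ(x; m, ε)`. -/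
noncomputable def RmaxW (μ : Measure ℝ) (m ε x : ℝ) : ℝ :=
  conv2 (fun y => m + callFn μ (y + ε) - (meanM μ - ε)) (fun y => callFn μ (y - ε)) x

/-- Right derivative. -/
noncomputable def rderiv (f : ℝ → ℝ) (x : ℝ) : ℝ := derivWithin f (Set.Ioi x) x

/-- `R` is a call function: convex, nonincreasing, tending to `0` at `+∞`, and
`R(x)+x` has a finite limit at `−∞`. -/
def IsCallFn (R : ℝ → ℝ) : Prop :=
  ConvexOn ℝ Set.univ R ∧ Antitone R ∧
    Tendsto R atTop (nhds 0) ∧ ∃ c : ℝ, Tendsto (fun x => R x + x) atBot (nhds c)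

/-- Stop-loss distance, valued in `[0,∞]`. -/
noncomputable def dSL (μ ν : Measure ℝ) : ℝ≥0∞ :=
  ⨆ x : ℝ, ENNReal.ofReal |callFn μ x - callFn ν x|

/-- Lévy distance. -/
noncomputable def dLevy (μ ν : Measure ℝ) : ℝ≥0∞ :=
  sInf (ENNReal.ofReal '' {h : ℝ | 0 < h ∧ ∀ x : ℝ,
    cdfM μ (x - h) - h ≤ cdfM ν x ∧ cdfM ν x ≤ cdfM μ (x + h) + h})

/-- Prokhorov distance on ℝ. -/
noncomputable def dProk (μ ν : Measure ℝ) : ℝ≥0∞ :=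
  sInf (ENNReal.ofReal '' {h : ℝ | 0 < h ∧ ∀ A : Set ℝ, IsClosed A →
    ν A ≤ μ (Metric.cthickening h A) + ENNReal.ofReal h})

/-- Modified Lévy distance with parameter `p`. -/
noncomputable def dLevyMod (p : ℝ) (μ ν : Measure ℝ) : ℝ≥0∞ :=
  sInf (ENNReal.ofReal '' {h : ℝ | 0 < h ∧ ∀ x : ℝ,
    cdfM μ (x - h) - p ≤ cdfM ν x ∧ cdfM ν x ≤ cdfM μ (x + h) + p})

/-- Modified Prokhorov distance with parameter `p`. -/
noncomputable def dProkMod (p : ℝ) (μ ν : Measure ℝ) : ℝ≥0∞ :=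
  sInf (ENNReal.ofReal '' {h : ℝ | 0 < h ∧ ∀ A : Set ℝ, IsClosed A →
    ν A ≤ μ (Metric.cthickening h A) + ENNReal.ofReal p})
/-! ### Layer-cake identities -/

lemma layer_right (σ : Measure ℝ) [SFinite σ] (x : ℝ) :
    ∫⁻ y, ENNReal.ofReal (y - x) ∂σ = ∫⁻ u in Ici x, σ (Ioi u) := by
  have hS : MeasurableSet {p : ℝ × ℝ | x ≤ p.2 ∧ p.2 < p.1} :=
    (measurableSet_le measurable_const measurable_snd).inter
      (measurableSet_lt measurable_snd measurable_fst)
  have h1 := Measure.prod_apply (μ := σ) (ν := (volume : Measure ℝ)) hS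
  have h2 := Measure.prod_apply_symm (μ := σ) (ν := (volume : Measure ℝ)) hS
  rw [h1] at h2
  rw [← lintegral_indicator measurableSet_Ici]
  convert h2 using 1
  · refine lintegral_congr fun y => ?_
    rw [← Real.volume_Ico]; rfl
  · refine lintegral_congr fun u => ?_
    by_cases hu : x ≤ u
    · rw [indicator_of_mem (mem_Ici.2 hu)]
      congr 1; ext y; simp [hu]
    · rw [indicator_of_notMem (by simpa using hu)]
      symm; convert measure_empty (μ := σ); ext y; simp [hu]

lemma layer_left (σ : Measure ℝ) [SFinite σ] (x : ℝ) :
    ∫⁻ y, ENNReal.ofReal (x - y) ∂σ = ∫⁻ u in Iio x, σ (Iic u) := by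
  have hS : MeasurableSet {p : ℝ × ℝ | p.1 ≤ p.2 ∧ p.2 < x} :=
    (measurableSet_le measurable_fst measurable_snd).inter
      (measurableSet_lt measurable_snd measurable_const)
  have h1 := Measure.prod_apply (μ := σ) (ν := (volume : Measure ℝ)) hS
  have h2 := Measure.prod_apply_symm (μ := σ) (ν := (volume : Measure ℝ)) hS
  rw [h1] at h2
  rw [← lintegral_indicator measurableSet_Iio]
  convert h2 using 1
  · refine lintegral_congr fun y => ?_
    rw [← Real.volume_Ico]; rfl
  · refine lintegral_congr fun u => ?_
    by_cases hu : u < x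
    · rw [indicator_of_mem (mem_Iio.2 hu)]
      congr 1; ext y; simp [hu]
    · rw [indicator_of_notMem (by simpa using hu)]
      symm; convert measure_empty (μ := σ); ext y; simp [hu]

/-- A convex function is the integral of a Stieltjes function. -/
lemma exists_stieltjes {φ : ℝ → ℝ} (hφ : ConvexOn ℝ univ φ) :
    ∃ f : StieltjesFunction ℝ, ∀ a b : ℝ, ∫ u in a..b, f u = φ b - φ a := by
  set d : ℝ → ℝ := fun x => derivWithin φ (Ioi x) x with hd
  have hmono : Monotone d := by
    have := hφ.monotoneOn_rightDeriv
    rw [interior_univ] at this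
    exact monotoneOn_univ.1 this
  refine ⟨hmono.stieltjesFunction, fun a b => ?_⟩
  have hae : ∀ᵐ u : ℝ, hmono.stieltjesFunction u = d u := by
    have hc : {u | ¬ ContinuousAt d u}.Countable := hmono.countable_not_continuousAt
    filter_upwards [hc.ae_notMem volume] with u hu
    have hu : ContinuousAt d u := by simpa using hu
    rw [hmono.stieltjesFunction_eq]
    exact hu.continuousWithinAt.rightLim_eq
  rw [intervalIntegral.integral_congr_ae (g := d) (by filter_upwards [hae] with u hu _ using hu)]
  refine intervalIntegral.integral_eq_sub_of_hasDeriv_right ?_ ?_ hmono.intervalIntegrable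
  · have := hφ.continuousOn_interior
    rw [interior_univ] at this
    exact this.mono (subset_univ _)
  · intro x _
    exact hφ.hasDerivWithinAt_rightDeriv_of_mem_interior (by simp)

lemma stieltjes_lower (f : StieltjesFunction ℝ) (a b : ℝ) :
    f a * (b - a) ≤ ∫ u in a..b, f u := by
  rcases le_total a b with h | h
  · calc f a * (b - a) = ∫ u in a..b, f a := by simp [mul_comm]
      _ ≤ _ := intervalIntegral.integral_mono_on h (by simp) f.mono.intervalIntegrable
        fun x hx => f.mono hx.1
  · rw [intervalIntegral.integral_symm]
    have : ∫ u in b..a, f u ≤ ∫ u in b..a, f a :=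
      intervalIntegral.integral_mono_on h f.mono.intervalIntegrable (by simp)
        fun x hx => f.mono hx.2
    simp at this
    nlinarith

/-- Interval integrals of nonnegative monotone/antitone things, as `lintegral`. -/
lemma lint_Ioc {g : ℝ → ℝ} {a b : ℝ} (hab : a ≤ b) (hg : IntervalIntegrable g volume a b)
    (h0 : ∀ u ∈ Ioc a b, 0 ≤ g u) :
    ∫⁻ u in Ioc a b, ENNReal.ofReal (g u) = ENNReal.ofReal (∫ u in a..b, g u) := by
  rw [intervalIntegral.integral_of_le hab, ofReal_integral_eq_lintegral_ofReal]
  · exact (intervalIntegrable_iff_integrableOn_Ioc_of_le hab).1 hg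
  · exact (ae_restrict_iff' measurableSet_Ioc).2 (ae_of_all _ h0)

lemma setLInt_shrink {A B : Set ℝ} (hA : MeasurableSet A) (hB : MeasurableSet B) (h : A ⊆ B)
    {g : ℝ → ℝ≥0∞} (h0 : ∀ u ∈ B \ A, g u = 0) :
    ∫⁻ u in B, g u = ∫⁻ u in A, g u := by
  rw [← lintegral_indicator hA, ← lintegral_indicator hB]
  refine lintegral_congr fun u => ?_
  by_cases hu : u ∈ A
  · rw [indicator_of_mem hu, indicator_of_mem (h hu)]
  · rw [indicator_of_notMem hu]
    by_cases hu' : u ∈ B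
    · rw [indicator_of_mem hu', h0 u ⟨hu', hu⟩]
    · rw [indicator_of_notMem hu']

lemma taylor_right (f : StieltjesFunction ℝ) {y : ℝ} (hy : 0 ≤ y) :
    ∫⁻ t in Ioi 0, ENNReal.ofReal (y - t) ∂f.measure
      = ENNReal.ofReal ((∫ u in (0:ℝ)..y, f u) - f 0 * y) := by
  rw [layer_left]
  have h1 : ∀ u, (f.measure.restrict (Ioi 0)) (Iic u) = ENNReal.ofReal (f u - f 0) := by
    intro u
    rw [Measure.restrict_apply measurableSet_Iic, ← f.measure_Ioc]
    congr 1; ext t; simp [and_comm]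
  simp_rw [h1]
  have h2 : ∫⁻ u in Iio y, ENNReal.ofReal (f u - f 0)
      = ∫⁻ u in Ioc 0 y, ENNReal.ofReal (f u - f 0) := by
    rw [setLIntegral_congr (Iio_ae_eq_Iic (a := y))]
    refine setLInt_shrink measurableSet_Ioc measurableSet_Iic
      (fun u hu => hu.2) fun u hu => ?_
    have : u ≤ 0 := by
      by_contra h; exact hu.2 ⟨not_le.1 h, hu.1⟩
    exact ENNReal.ofReal_of_nonpos (by linarith [f.mono this])
  rw [h2, lint_Ioc hy (f.mono.intervalIntegrable.sub (by simp))
    (fun u hu => by linarith [f.mono hu.1.le]),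
    intervalIntegral.integral_sub f.mono.intervalIntegrable (by simp)]
  simp [mul_comm]

lemma taylor_left (f : StieltjesFunction ℝ) {y : ℝ} (hy : y ≤ 0) :
    ∫⁻ t in Iic 0, ENNReal.ofReal (t - y) ∂f.measure
      = ENNReal.ofReal ((∫ u in (0:ℝ)..y, f u) - f 0 * y) := by
  rw [layer_right]
  have h1 : ∀ u, (f.measure.restrict (Iic 0)) (Ioi u) = ENNReal.ofReal (f 0 - f u) := by
    intro u
    rw [Measure.restrict_apply measurableSet_Ioi, ← f.measure_Ioc]
    congr 1
  simp_rw [h1]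
  have h2 : ∫⁻ u in Ici y, ENNReal.ofReal (f 0 - f u)
      = ∫⁻ u in Ioc y 0, ENNReal.ofReal (f 0 - f u) := by
    rw [setLIntegral_congr (Ioi_ae_eq_Ici (a := y)).symm]
    refine setLInt_shrink measurableSet_Ioc measurableSet_Ioi
      (fun u hu => hu.1) fun u hu => ?_
    have : 0 ≤ u := by
      by_contra h; exact hu.2 ⟨hu.1, (not_le.1 h).le⟩
    exact ENNReal.ofReal_of_nonpos (by linarith [f.mono this])
  rw [h2, lint_Ioc hy (IntervalIntegrable.sub (by simp) f.mono.intervalIntegrable)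
    (fun u hu => by linarith [f.mono hu.2]),
    intervalIntegral.integral_sub (by simp) f.mono.intervalIntegrable,
    intervalIntegral.integral_symm y 0]
  congr 1; simp; ring

lemma taylor (f : StieltjesFunction ℝ) (y : ℝ) :
    ENNReal.ofReal ((∫ u in (0:ℝ)..y, f u) - f 0 * y)
      = ∫⁻ t in Ioi 0, ENNReal.ofReal (y - t) ∂f.measure
        + ∫⁻ t in Iic 0, ENNReal.ofReal (t - y) ∂f.measure := by
  rcases le_total 0 y with hy | hy
  · rw [taylor_right f hy, setLIntegral_congr_fun (g := 0) measurableSet_Iic]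
    · simp
    · intro t ht
      exact ENNReal.ofReal_of_nonpos (by have : t ≤ 0 := ht; linarith)
  · rw [taylor_left f hy, setLIntegral_congr_fun (s := Ioi 0) (g := 0) measurableSet_Ioi]
    · simp
    · intro t ht
      exact ENNReal.ofReal_of_nonpos (by have : 0 < t := ht; linarith)

/-! ### Calls and puts -/

lemma int_call {μ : Measure ℝ} (h : MemM μ) (x : ℝ) : Integrable (fun y => max (y - x) 0) μ := by
  have := h.1
  exact (h.2.sub (integrable_const x)).pos_part

lemma lint_call {μ : Measure ℝ} (h : MemM μ) (x : ℝ) :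
    ∫⁻ y, ENNReal.ofReal (y - x) ∂μ = ENNReal.ofReal (callFn μ x) := by
  rw [callFn, ofReal_integral_eq_lintegral_ofReal (int_call h x)
    (ae_of_all _ fun y => le_max_right _ _)]
  refine lintegral_congr fun y => ?_
  rw [ENNReal.ofReal_max]; simp

lemma lint_put {μ : Measure ℝ} (h : MemM μ) (x : ℝ) :
    ∫⁻ y, ENNReal.ofReal (x - y) ∂μ = ENNReal.ofReal (callFn μ x + x - meanM μ) := by
  have := h.1
  have e : callFn μ x + x - meanM μ = ∫ y, max (x - y) 0 ∂μ := by
    have : ∀ y, max (x - y) 0 = max (y - x) 0 + x - y := by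
      intro y
      rcases le_total x y with h | h
      · rw [max_eq_right (by linarith), max_eq_left (by linarith)]; ring
      · rw [max_eq_left (by linarith), max_eq_right (by linarith)]; ring
    simp_rw [this]
    have i1 : Integrable (fun y => max (y - x) 0 + x) μ := (int_call h x).add (integrable_const x)
    rw [integral_sub i1 h.2, integral_add (int_call h x) (integrable_const x)]
    simp [callFn, meanM]
  have i2 : Integrable (fun y => max (x - y) 0) μ := ((integrable_const x).sub h.2).pos_part
  rw [e, ofReal_integral_eq_lintegral_ofReal i2
    (ae_of_all _ fun y => le_max_right _ _)]
  refine lintegral_congr fun y => ?_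
  rw [ENNReal.ofReal_max]; simp

lemma lint_convex {μ : Measure ℝ} (h : MemM μ) (f : StieltjesFunction ℝ) :
    ∫⁻ y, ENNReal.ofReal ((∫ u in (0:ℝ)..y, f u) - f 0 * y) ∂μ
      = ∫⁻ t in Ioi 0, ENNReal.ofReal (callFn μ t) ∂f.measure
        + ∫⁻ t in Iic 0, ENNReal.ofReal (callFn μ t + t - meanM μ) ∂f.measure := by
  have := h.1
  simp_rw [taylor]
  rw [lintegral_add_left]
  · congr 1
    · rw [lintegral_lintegral_swap (by fun_prop)]
      simp_rw [lint_call h]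
    · rw [lintegral_lintegral_swap (by fun_prop)]
      simp_rw [lint_put h]
  · exact Measurable.lintegral_prod_right' (f := fun p : ℝ × ℝ => ENNReal.ofReal (p.1 - p.2))
      (by fun_prop)

lemma convexOrder_of_call {μ ν : Measure ℝ} (hμ : MemM μ) (hν : MemM ν)
    (hm : meanM μ = meanM ν) (hc : ∀ x, callFn μ x ≤ callFn ν x) : ConvexOrder μ ν := by
  intro φ hφ iμ iν
  have := hμ.1
  have := hν.1
  obtain ⟨f, hf⟩ := exists_stieltjes hφ
  have key : ∀ ρ : Measure ℝ, MemM ρ → Integrable φ ρ →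
      (Integrable (fun y => φ y - φ 0 - f 0 * y) ρ ∧
      ∫ y, (φ y - φ 0 - f 0 * y) ∂ρ = ∫ y, φ y ∂ρ - φ 0 - f 0 * meanM ρ) := by
    intro ρ h i
    have := h.1
    refine ⟨(i.sub (integrable_const _)).sub (h.2.const_mul _), ?_⟩
    have i1 : Integrable (fun y => φ y - φ 0) ρ := i.sub (integrable_const _)
    rw [integral_sub i1 (h.2.const_mul _), integral_sub i (integrable_const _), integral_const_mul]
    simp [meanM]
  have nn : ∀ y, 0 ≤ φ y - φ 0 - f 0 * y := by
    intro y
    have := stieltjes_lower f 0 y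
    rw [hf] at this; simp at this; linarith
  obtain ⟨i1, e1⟩ := key μ hμ iμ
  obtain ⟨i2, e2⟩ := key ν hν iν
  have l1 := lint_convex hμ f
  have l2 := lint_convex hν f
  simp_rw [hf] at l1 l2
  rw [← ofReal_integral_eq_lintegral_ofReal i1 (ae_of_all _ nn)] at l1
  rw [← ofReal_integral_eq_lintegral_ofReal i2 (ae_of_all _ nn)] at l2
  have : ENNReal.ofReal (∫ y, (φ y - φ 0 - f 0 * y) ∂μ)
      ≤ ENNReal.ofReal (∫ y, (φ y - φ 0 - f 0 * y) ∂ν) := by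
    rw [l1, l2]
    refine add_le_add (lintegral_mono fun t => ENNReal.ofReal_le_ofReal (hc t))
      (lintegral_mono fun t => ENNReal.ofReal_le_ofReal ?_)
    have := hc t
    rw [hm]; linarith
  rw [ENNReal.ofReal_le_ofReal_iff (integral_nonneg nn), e1, e2, hm] at this
  linarith

/-! ### From call functions to measures -/

/-- Convex, tends to `0` at `+∞`, and `R x + x → m` at `-∞`. -/
def GoodCall (m : ℝ) (R : ℝ → ℝ) : Prop :=
  ConvexOn ℝ univ R ∧ Tendsto R atTop (nhds 0) ∧ Tendsto (fun x => R x + x) atBot (nhds m)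

lemma GoodCall.exists_measure {m : ℝ} {R : ℝ → ℝ} (h : GoodCall m R) :
    ∃ ν : Measure ℝ, MemM ν ∧ meanM ν = m ∧ ∀ x, callFn ν x = R x := by
  obtain ⟨hconv, htop, hbot⟩ := h
  obtain ⟨f, hf⟩ := exists_stieltjes hconv
  have lo : ∀ x, R x - R (x - 1) ≤ f x := by
    intro x
    have := stieltjes_lower f x (x - 1)
    rw [hf] at this; linarith
  have up : ∀ x, f x ≤ R (x + 1) - R x := by
    intro x
    have := stieltjes_lower f x (x + 1)
    rw [hf] at this; linarith
  have ftop : Tendsto f atTop (nhds 0) := by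
    refine tendsto_of_tendsto_of_tendsto_of_le_of_le (g := fun x => R x - R (x - 1))
      (h := fun x => R (x + 1) - R x) ?_ ?_ lo up
    · simpa [sub_eq_add_neg] using htop.sub (htop.comp (tendsto_atTop_add_const_right _ (-1 : ℝ) tendsto_id))
    · simpa using (htop.comp (tendsto_atTop_add_const_right _ (1 : ℝ) tendsto_id)).sub htop
  have fbot : Tendsto f atBot (nhds (-1)) := by
    refine tendsto_of_tendsto_of_tendsto_of_le_of_le (g := fun x => R x - R (x - 1))
      (h := fun x => R (x + 1) - R x) ?_ ?_ lo up
    · have := (hbot.sub (hbot.comp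
        (tendsto_atBot_add_const_right _ (-1 : ℝ) tendsto_id))).sub_const 1
      simp only [sub_self, zero_sub] at this
      refine this.congr fun x => ?_
      simp only [Function.comp, id]; rw [← sub_eq_add_neg]; ring
    · have := ((hbot.comp
        (tendsto_atBot_add_const_right _ (1 : ℝ) tendsto_id)).sub hbot).sub_const 1
      simp only [sub_self, zero_sub] at this
      refine this.congr fun x => ?_
      simp only [Function.comp, id]; ring
  have f0 : ∀ x, f x ≤ 0 := fun x => f.mono.ge_of_tendsto ftop x
  have f1 : ∀ x, -1 ≤ f x := fun x => f.mono.le_of_tendsto fbot x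
  have anti : Antitone R := by
    intro a b hab
    have := stieltjes_lower f b a
    rw [hf] at this
    nlinarith [f0 b]
  have mono : Monotone (fun x => R x + x) := by
    intro a b hab
    have := stieltjes_lower f a b
    rw [hf] at this
    simp only
    nlinarith [f1 a]
  have R0 : ∀ x, 0 ≤ R x := fun x => anti.le_of_tendsto htop x
  have Rm : ∀ x, m ≤ R x + x := fun x => mono.le_of_tendsto hbot x
  have hprob : IsProbabilityMeasure f.measure := by
    refine ⟨?_⟩
    rw [f.measure_univ fbot ftop]; norm_num
  have hcall : ∀ x, ∫⁻ y, ENNReal.ofReal (y - x) ∂f.measure = ENNReal.ofReal (R x) := by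
    intro x
    rw [layer_right]
    simp_rw [f.measure_Ioi ftop]
    have hc : AECover (volume.restrict (Ici x)) atTop (fun b : ℝ => Iic b) := aecover_Iic tendsto_id
    have t1 := hc.lintegral_tendsto_of_countably_generated
      (f := fun u => ENNReal.ofReal (0 - f u))
      (measurable_const.sub f.mono.measurable).ennreal_ofReal.aemeasurable
    refine tendsto_nhds_unique t1 ?_
    have t2 : Tendsto (fun b => ENNReal.ofReal (R x - R b)) atTop (nhds (ENNReal.ofReal (R x))) := by
      have := ENNReal.tendsto_ofReal (htop.const_sub (R x))
      simpa using this
    refine t2.congr' ?_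
    filter_upwards [eventually_ge_atTop x] with b hb
    rw [Measure.restrict_restrict measurableSet_Iic, inter_comm, Ici_inter_Iic,
      setLIntegral_congr (Ioc_ae_eq_Icc (a := x) (b := b)).symm,
      lint_Ioc hb (IntervalIntegrable.sub (by simp) f.mono.intervalIntegrable)
        (fun u _ => by linarith [f0 u]),
      intervalIntegral.integral_sub (by simp) f.mono.intervalIntegrable, hf]
    congr 1; simp
  have hput : ∀ x, ∫⁻ y, ENNReal.ofReal (x - y) ∂f.measure = ENNReal.ofReal (R x + x - m) := by
    intro x
    rw [layer_left]
    simp_rw [f.measure_Iic fbot]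
    have hc : AECover (volume.restrict (Iio x)) atBot (fun b : ℝ => Ioi b) := aecover_Ioi tendsto_id
    have t1 := hc.lintegral_tendsto_of_countably_generated
      (f := fun u => ENNReal.ofReal (f u - -1))
      (f.mono.measurable.sub measurable_const).ennreal_ofReal.aemeasurable
    refine tendsto_nhds_unique t1 ?_
    have t2 : Tendsto (fun b => ENNReal.ofReal (R x + x - (R b + b))) atBot
        (nhds (ENNReal.ofReal (R x + x - m))) :=
      ENNReal.tendsto_ofReal (hbot.const_sub (R x + x))
    refine t2.congr' ?_
    filter_upwards [eventually_le_atBot x] with b hb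
    rw [Measure.restrict_restrict measurableSet_Ioi, Ioi_inter_Iio,
      setLIntegral_congr (Ioo_ae_eq_Ioc (a := b) (b := x)),
      lint_Ioc hb (f.mono.intervalIntegrable.sub (by simp))
        (fun u _ => by linarith [f1 u]),
      intervalIntegral.integral_sub f.mono.intervalIntegrable (by simp), hf]
    congr 1; simp; ring
  have hmem : MemM f.measure := by
    refine ⟨hprob, measurable_id.aestronglyMeasurable, ?_⟩
    have e : ∀ y : ℝ, ‖y‖ₑ = ENNReal.ofReal (y - 0) + ENNReal.ofReal (0 - y) := by
      intro y
      rw [← ofReal_norm, Real.norm_eq_abs]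
      rcases le_total 0 y with h | h
      · rw [abs_of_nonneg h, ENNReal.ofReal_of_nonpos (p := 0 - y) (by linarith)]; simp
      · rw [abs_of_nonpos h, ENNReal.ofReal_of_nonpos (p := y - 0) (by linarith)]; simp
    unfold HasFiniteIntegral
    simp_rw [e]
    rw [lintegral_add_left (by fun_prop), hcall, hput]
    exact ENNReal.add_lt_top.2 ⟨ENNReal.ofReal_lt_top, ENNReal.ofReal_lt_top⟩
  have hcc : ∀ x, callFn f.measure x = R x := by
    intro x
    have := lint_call hmem x
    rw [hcall] at this
    exact ((ENNReal.ofReal_eq_ofReal_iff (R0 x)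
      (integral_nonneg fun y => le_max_right _ _)).1 this).symm
  refine ⟨f.measure, hmem, ?_, hcc⟩
  have := lint_put hmem 0
  rw [hput, hcc, ENNReal.ofReal_eq_ofReal_iff (by linarith [Rm 0])] at this
  · linarith
  · rw [← hcc]
    have : meanM f.measure ≤ callFn f.measure 0 :=
      integral_mono hmem.2 (int_call hmem 0) fun y => by simp
    linarith

lemma callFn_convex {μ : Measure ℝ} (h : MemM μ) : ConvexOn ℝ univ (callFn μ) := by
  refine ⟨convex_univ, fun x _ y _ a b ha hb hab => ?_⟩
  simp only [callFn, smul_eq_mul]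
  rw [← integral_const_mul, ← integral_const_mul,
    ← integral_add ((int_call h x).const_mul a) ((int_call h y).const_mul b)]
  refine integral_mono (int_call h _) (((int_call h x).const_mul a).add
    ((int_call h y).const_mul b)) fun z => ?_
  have h1 := mul_le_mul_of_nonneg_left (le_max_left (z - x) 0) ha
  have h2 := mul_le_mul_of_nonneg_left (le_max_left (z - y) 0) hb
  have h3 := mul_nonneg ha (le_max_right (z - x) 0)
  have h4 := mul_nonneg hb (le_max_right (z - y) 0)
  refine max_le ?_ (add_nonneg h3 h4)
  have : z - (a * x + b * y) = a * (z - x) + b * (z - y) := by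
    linear_combination (-z) * hab
  simp only
  linarith

lemma callFn_tendsto {μ : Measure ℝ} (h : MemM μ) : Tendsto (callFn μ) atTop (nhds 0) := by
  have : Tendsto (callFn μ) atTop (nhds (∫ _, (0:ℝ) ∂μ)) := by
    refine tendsto_integral_filter_of_dominated_convergence (fun y => |y|) ?_ ?_ h.2.abs ?_
    · exact Eventually.of_forall fun x => (int_call h x).1
    · filter_upwards [eventually_ge_atTop 0] with x hx
      refine ae_of_all _ fun y => ?_
      rw [Real.norm_eq_abs, abs_of_nonneg (le_max_right _ _)]
      exact max_le (by linarith [le_abs_self y]) (abs_nonneg y)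
    · refine ae_of_all _ fun y => tendsto_const_nhds.congr' ?_
      filter_upwards [eventually_ge_atTop y] with x hx
      rw [max_eq_right (by linarith)]
  simpa using this

lemma callFn_tendsto_bot {μ : Measure ℝ} (h : MemM μ) :
    Tendsto (fun x => callFn μ x + x) atBot (nhds (meanM μ)) := by
  have := h.1
  have e : ∀ x, callFn μ x + x = ∫ y, (max (y - x) 0 + x) ∂μ := by
    intro x
    rw [integral_add (int_call h x) (integrable_const x)]; simp [callFn]
  simp_rw [e]
  refine tendsto_integral_filter_of_dominated_convergence (fun y => |y|) ?_ ?_ h.2.abs ?_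
  · exact Eventually.of_forall fun x => ((int_call h x).add (integrable_const x)).1
  · filter_upwards [eventually_le_atBot 0] with x hx
    refine ae_of_all _ fun y => ?_
    rw [Real.norm_eq_abs, max_add]
    simp only [sub_add_cancel, zero_add]
    rw [abs_le]
    exact ⟨(neg_abs_le y).trans (le_max_left _ _), max_le (le_abs_self y)
      (hx.trans (abs_nonneg y))⟩
  · refine ae_of_all _ fun y => tendsto_const_nhds.congr' ?_
    filter_upwards [eventually_le_atBot y] with x hx
    rw [max_eq_left (by linarith)]; ring

lemma GoodCall.max_call {m ε : ℝ} (hε : 0 < ε) {R : ℝ → ℝ} (hR : GoodCall m R) {μ : Measure ℝ}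
    (h : MemM μ) (hm : meanM μ - ε ≤ m) : GoodCall m (fun x => max (R x) (callFn μ x - ε)) := by
  obtain ⟨h1, h2, h3⟩ := hR
  refine ⟨h1.sup ((callFn_convex h).add_const (-ε)), ?_, ?_⟩
  · have := h2.max ((callFn_tendsto h).sub_const ε)
    rwa [max_eq_left (by linarith)] at this
  · have := h3.max ((callFn_tendsto_bot h).sub_const ε)
    rw [max_eq_left hm] at this
    refine this.congr fun x => ?_
    rw [max_add]; congr 1; ring

/-! ### The perturbed lower bound -/

/-- Call function of a two-point law on `m - ε` and `K`. -/
noncomputable def twoPt (m ε K x : ℝ) : ℝ := max (max (m - x) 0) (ε / (K - m + ε) * (K - x))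

lemma twoPt_slope {m ε K : ℝ} (hε : 0 < ε) (hK : m < K) :
    0 < ε / (K - m + ε) ∧ ε / (K - m + ε) ≤ 1 ∧ ε / (K - m + ε) * (K - m + ε) = ε := by
  have : 0 < K - m + ε := by linarith
  refine ⟨by positivity, (div_le_one this).2 (by linarith), div_mul_cancel₀ _ this.ne'⟩

lemma twoPt_of_le {m ε K x : ℝ} (hε : 0 < ε) (hK : m < K) (hx : x ≤ m - ε) :
    twoPt m ε K x = m - x := by
  obtain ⟨h0, h1, h2⟩ := twoPt_slope hε hK
  unfold twoPt
  rw [max_eq_left (a := m - x) (by linarith), max_eq_left]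
  nlinarith

lemma twoPt_le {m ε K x : ℝ} (hε : 0 < ε) (hK : m < K) (hx : m - ε ≤ x) :
    twoPt m ε K x ≤ ε := by
  obtain ⟨h0, h1, h2⟩ := twoPt_slope hε hK
  refine max_le (max_le (by linarith) hε.le) ?_
  nlinarith

lemma twoPt_zero {m ε K x : ℝ} (hε : 0 < ε) (hK : m < K) (hx : K ≤ x) :
    twoPt m ε K x = 0 := by
  obtain ⟨h0, h1, h2⟩ := twoPt_slope hε hK
  unfold twoPt
  rw [max_eq_right (a := m - x) (by linarith), max_eq_left]
  nlinarith

lemma twoPt_pos {m ε K x : ℝ} (hε : 0 < ε) (hK : m < K) (hx : x < K) :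
    0 < twoPt m ε K x :=
  lt_of_lt_of_le (mul_pos (twoPt_slope hε hK).1 (by linarith)) (le_max_right _ _)

lemma twoPt_good {m ε K : ℝ} (hε : 0 < ε) (hK : m < K) : GoodCall m (twoPt m ε K) := by
  have aff : ∀ c d : ℝ, ConvexOn ℝ univ (fun x : ℝ => c * (d - x)) := by
    intro c d
    refine ⟨convex_univ, fun x _ y _ a b _ _ hab => le_of_eq ?_⟩
    simp only [smul_eq_mul]
    linear_combination -c * d * hab
  refine ⟨?_, ?_, ?_⟩
  · have h1 := aff 1 m
    simp only [one_mul] at h1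
    exact (h1.sup (convexOn_const 0 convex_univ)).sup (aff _ K)
  · refine tendsto_const_nhds.congr' ?_
    filter_upwards [eventually_ge_atTop K] with x hx
    rw [twoPt_zero hε hK hx]
  · refine tendsto_const_nhds.congr' ?_
    filter_upwards [eventually_le_atBot (m - ε)] with x hx
    rw [twoPt_of_le hε hK hx]; ring

/-- The increasing sequence of call functions. -/
noncomputable def seqCall (μ : ℕ → Measure ℝ) (m ε K : ℝ) : ℕ → ℝ → ℝ
  | 0 => fun x => max (twoPt m ε K x) (callFn (μ 0) x - ε)
  | n + 1 => fun x => max (seqCall μ m ε K n x) (callFn (μ (n + 1)) x - ε)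

lemma seqCall_good {μ : ℕ → Measure ℝ} {m ε K : ℝ} (hε : 0 < ε) (hK : m < K)
    (hμ : ∀ n, MemM (μ n)) (hm : ∀ n, meanM (μ n) - ε ≤ m) (n : ℕ) :
    GoodCall m (seqCall μ m ε K n) := by
  induction n with
  | zero => exact (twoPt_good hε hK).max_call hε (hμ 0) (hm 0)
  | succ n ih => exact ih.max_call hε (hμ _) (hm _)

lemma seqCall_mono (μ : ℕ → Measure ℝ) (m ε K x : ℝ) : Monotone (fun n => seqCall μ m ε K n x) :=
  monotone_nat_of_le_succ fun _ => le_max_left _ _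

lemma seqCall_lower (μ : ℕ → Measure ℝ) (m ε K x : ℝ) (n : ℕ) :
    callFn (μ n) x - ε ≤ seqCall μ m ε K n x := by
  cases n <;> exact le_max_right _ _

lemma seqCall_upper {μ : ℕ → Measure ℝ} {m ε K : ℝ} (hε : 0 < ε) (hK : m < K)
    (hcond : ∀ k n : ℕ, k ≤ n → ∀ x : ℝ,
      max (max (m - x) 0) (callFn (μ k) x - ε) ≤ callFn (μ n) x + ε) (x : ℝ) (k n : ℕ)
    (hkn : k ≤ n) : seqCall μ m ε K k x ≤ callFn (μ n) x + ε := by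
  induction k with
  | zero =>
    refine max_le ?_ ((le_max_right _ _).trans (hcond 0 n hkn x))
    rcases le_total x (m - ε) with h | h
    · rw [twoPt_of_le hε hK h]
      exact ((le_max_left _ _).trans (le_max_left _ _)).trans (hcond 0 n hkn x)
    · refine (twoPt_le hε hK h).trans ?_
      have : 0 ≤ callFn (μ n) x := integral_nonneg fun y => le_max_right _ _
      linarith
  | succ k ih =>
    exact max_le (ih (by omega)) ((le_max_right _ _).trans (hcond _ n hkn x))

/-- under the stop-loss condition, there are infinitely many peacocks
within stop-loss distance `ε` of `(μ_n)`. -/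
theorem infinitely_many_stoploss_peacocks (ε : ℝ) (hε : 0 < ε)
    (μ : ℕ → Measure ℝ) (hμ : ∀ n, MemM (μ n))
    (m : ℝ) (hm : m ∈ ⋂ n : ℕ, Set.Icc (meanM (μ n) - ε) (meanM (μ n) + ε))
    (hcond : ∀ k n : ℕ, k ≤ n → ∀ x : ℝ,
      max (max (m - x) 0) (callFn (μ k) x - ε) ≤ callFn (μ n) x + ε) :
    {ν : ℕ → Measure ℝ | (∀ n, MemM (ν n)) ∧
      (∀ j k : ℕ, j ≤ k → ConvexOrder (ν j) (ν k)) ∧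
      (∀ n, dSL (μ n) (ν n) ≤ ENNReal.ofReal ε)}.Infinite := by
  have hm' : ∀ n, meanM (μ n) - ε ≤ m := fun n => (mem_iInter.1 hm n).1
  obtain ⟨x₀, hx₀⟩ : ∃ x₀, ∀ x ≥ x₀, callFn (μ 0) x ≤ ε :=
    eventually_atTop.1 ((callFn_tendsto (hμ 0)).eventually (ge_mem_nhds hε))
  set K : ℕ → ℝ := fun i => max x₀ m + 1 + i with hKdef
  have hKm : ∀ i, m < K i := fun i => by
    have := le_max_right x₀ m
    have : (0:ℝ) ≤ i := Nat.cast_nonneg i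
    simp only [hKdef]; linarith
  have hKx : ∀ i, x₀ ≤ K i := fun i => by
    have := le_max_left x₀ m
    have : (0:ℝ) ≤ i := Nat.cast_nonneg i
    simp only [hKdef]; linarith
  choose ν hν1 hν2 hν3 using fun i n =>
    (seqCall_good hε (hKm i) hμ hm' n).exists_measure
  refine Set.infinite_of_injective_forall_mem (f := ν) ?_ ?_
  · have key : ∀ i j, i < j → ν i ≠ ν j := by
      intro i j hij he
      have h1 := hν3 i 0 (K i)
      rw [he, hν3 j 0 (K i)] at h1
      have hlt : K i < K j := by
        simp only [hKdef]
        have : (i : ℝ) < j := by exact_mod_cast hij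
        linarith
      have h2 : 0 < seqCall μ m ε (K j) 0 (K i) :=
        lt_of_lt_of_le (twoPt_pos hε (hKm j) hlt) (le_max_left _ _)
      have h3 : seqCall μ m ε (K i) 0 (K i) ≤ 0 :=
        max_le (twoPt_zero hε (hKm i) le_rfl).le (by linarith [hx₀ (K i) (hKx i)])
      linarith
    intro i j he
    rcases lt_trichotomy i j with h | h | h
    · exact absurd he (key i j h)
    · exact h
    · exact absurd he.symm (key j i h)
  · intro i
    refine ⟨hν1 i, fun j k hjk => ?_, fun n => ?_⟩
    · refine convexOrder_of_call (hν1 i j) (hν1 i k) (by rw [hν2, hν2]) fun x => ?_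
      rw [hν3, hν3]
      exact seqCall_mono μ m ε (K i) x hjk
    · refine iSup_le fun x => ENNReal.ofReal_le_ofReal ?_
      rw [hν3, abs_le]
      have h1 := seqCall_lower μ m ε (K i) x n
      have h2 := seqCall_upper hε (hKm i) hcond x n n le_rfl
      constructor <;> linarith
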